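/- Under the stated second-order heavy-tailed specification augmented with the density-level decay conditions, define f(x,y) = ∂F(x,y)/∂y. Let η > 0 and let (u_n) and (T_n) be sequences with u_n → ∞, T_n → ∞, and T_n^{−η}·log u_n → 0. Then f(x_0, u_n) > 0 for all sufficiently large n, and T_n^{−η} · sup{ ‖∇_x f(x, u_n)‖ : ‖x − x_0‖ ≤ T_n^{−η} } / f(x_0, u_n) → 0 as n → ∞. -/

import Mathlib

open Filter Real

/-- The second-order heavy-tailed specification
`F(x,y) = 1 − c(x)·y^{−γ(x)}·(1 + d(x)·y^{−γ̃(x)} + r(x,y))` (Condition B(i) of the paper). -/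
noncomputable def heavyTailCDF {p : ℕ} (c d γ γt : EuclideanSpace ℝ (Fin p) → ℝ)
    (r : EuclideanSpace ℝ (Fin p) → ℝ → ℝ) (x : EuclideanSpace ℝ (Fin p)) (y : ℝ) : ℝ :=
  1 - c x * y ^ (-γ x) * (1 + d x * y ^ (-γt x) + r x y)

/-- The associated conditional density `f(x,y) = ∂F(x,y)/∂y`. -/
noncomputable def heavyTailPDF {p : ℕ} (c d γ γt : EuclideanSpace ℝ (Fin p) → ℝ)
    (r : EuclideanSpace ℝ (Fin p) → ℝ → ℝ) (x : EuclideanSpace ℝ (Fin p)) (y : ℝ) : ℝ :=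
  deriv (fun y' => heavyTailCDF c d γ γt r x y') y

section C1Bounds

variable {E : Type*} [NormedAddCommGroup E] [NormedSpace ℝ E]

/-- `f` is differentiable at `x`, with value at most `a` and gradient at most `a * ℓ`. -/
structure HasC1Bound (ℓ a : ℝ) (f : E → ℝ) (x : E) : Prop where
  differentiableAt : DifferentiableAt ℝ f x
  abs_le : |f x| ≤ a
  norm_fderiv_le : ‖fderiv ℝ f x‖ ≤ a * ℓ

namespace HasC1Bound

variable {ℓ a b : ℝ} {f g : E → ℝ} {x : E}

theorem nonneg (hf : HasC1Bound ℓ a f x) : 0 ≤ a :=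
  (abs_nonneg _).trans hf.abs_le

theorem of_le (hℓ : 1 ≤ ℓ) (hd : DifferentiableAt ℝ f x) (h₀ : |f x| ≤ a)
    (h₁ : ‖fderiv ℝ f x‖ ≤ a) : HasC1Bound ℓ a f x :=
  ⟨hd, h₀, h₁.trans (le_mul_of_one_le_right ((abs_nonneg _).trans h₀) hℓ)⟩

theorem add (hf : HasC1Bound ℓ a f x) (hg : HasC1Bound ℓ b g x) :
    HasC1Bound ℓ (a + b) (fun z => f z + g z) x where
  differentiableAt := hf.differentiableAt.add hg.differentiableAt
  abs_le := (abs_add_le _ _).trans (add_le_add hf.abs_le hg.abs_le)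
  norm_fderiv_le := by
    rw [fderiv_fun_add hf.differentiableAt hg.differentiableAt, add_mul]
    exact (norm_add_le _ _).trans (add_le_add hf.norm_fderiv_le hg.norm_fderiv_le)

theorem sub (hf : HasC1Bound ℓ a f x) (hg : HasC1Bound ℓ b g x) :
    HasC1Bound ℓ (a + b) (fun z => f z - g z) x where
  differentiableAt := hf.differentiableAt.sub hg.differentiableAt
  abs_le := (abs_sub _ _).trans (add_le_add hf.abs_le hg.abs_le)
  norm_fderiv_le := by
    rw [fderiv_fun_sub hf.differentiableAt hg.differentiableAt, add_mul]
    exact (norm_sub_le _ _).trans (add_le_add hf.norm_fderiv_le hg.norm_fderiv_le)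

theorem mul (hf : HasC1Bound ℓ a f x) (hg : HasC1Bound ℓ b g x) :
    HasC1Bound ℓ (2 * (a * b)) (fun z => f z * g z) x where
  differentiableAt := hf.differentiableAt.mul hg.differentiableAt
  abs_le := by
    have := mul_nonneg hf.nonneg hg.nonneg
    rw [abs_mul]
    linarith [mul_le_mul hf.abs_le hg.abs_le (abs_nonneg _) hf.nonneg]
  norm_fderiv_le := by
    rw [fderiv_fun_mul hf.differentiableAt hg.differentiableAt]
    refine (norm_add_le _ _).trans ?_
    rw [norm_smul, norm_smul, Real.norm_eq_abs, Real.norm_eq_abs]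
    have h₁ := mul_le_mul hf.abs_le hg.norm_fderiv_le (norm_nonneg _) hf.nonneg
    have h₂ := mul_le_mul hg.abs_le hf.norm_fderiv_le (norm_nonneg _) hg.nonneg
    linarith

theorem rpow_neg {y : ℝ} (hy : 1 ≤ y) (hf : DifferentiableAt ℝ f x)
    (hb : ‖fderiv ℝ f x‖ ≤ b) :
    HasC1Bound (1 + log y) ((1 + b) * y ^ (-f x)) (fun z => y ^ (-f z)) x := by
  have hy0 : 0 < y := zero_lt_one.trans_le hy
  have hw : 0 < y ^ (-f x) := rpow_pos_of_pos hy0 _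
  have hL : 0 ≤ log y := log_nonneg hy
  have hb0 : 0 ≤ b := (norm_nonneg _).trans hb
  have hder := hf.hasFDerivAt.neg.const_rpow hy0
  refine ⟨hder.differentiableAt, ?_, ?_⟩
  · rw [abs_of_pos hw]
    nlinarith
  · have hfd := hder.fderiv
    simp only [Pi.neg_apply] at hfd
    rw [hfd, norm_smul, norm_neg, Real.norm_eq_abs, abs_of_nonneg (by positivity)]
    calc y ^ (-f x) * log y * ‖fderiv ℝ f x‖ ≤ y ^ (-f x) * log y * b := by gcongr
      _ ≤ (1 + b) * y ^ (-f x) * (1 + log y) := by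
        nlinarith [mul_nonneg hw.le hL, mul_nonneg hw.le hb0]

end HasC1Bound

theorem exists_hasC1Bound_closedBall [ProperSpace E] {f : E → ℝ} (hf : ContDiff ℝ 1 f)
    (x₀ : E) (δ : ℝ) :
    ∃ M, ∀ ℓ, 1 ≤ ℓ → ∀ x ∈ Metric.closedBall x₀ δ, HasC1Bound ℓ M f x := by
  obtain ⟨A, hA⟩ := (isCompact_closedBall x₀ δ).exists_bound_of_continuousOn
    hf.continuous.continuousOn
  obtain ⟨B, hB⟩ := (isCompact_closedBall x₀ δ).exists_bound_of_continuousOn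
    (hf.continuous_fderiv one_ne_zero).continuousOn
  exact ⟨max A B, fun ℓ hℓ x hx => .of_le hℓ (hf.differentiable one_ne_zero x)
    ((hA x hx).trans (le_max_left _ _)) ((hB x hx).trans (le_max_right _ _))⟩

theorem le_of_mul_rpow_le {a y s ε : ℝ} (hy : 1 ≤ y) (hs : 0 ≤ s) (ha : 0 ≤ a)
    (h : a * y ^ s ≤ ε) : a ≤ ε :=
  (le_mul_of_one_le_right ha (one_le_rpow hy hs)).trans h

theorem mul_le_of_mul_rpow_add_one_le {a y s ε : ℝ} (hy : 1 ≤ y) (hs : 0 ≤ s) (ha : 0 ≤ a)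
    (h : a * y ^ (s + 1) ≤ ε) : y * a ≤ ε := by
  have hy0 : 0 < y := zero_lt_one.trans_le hy
  refine le_of_mul_rpow_le hy hs (by positivity) (le_trans (le_of_eq ?_) h)
  rw [rpow_add_one hy0.ne']
  ring

/-- The bracket in the factorisation `f(x,y) = c(x) · y^{−(γ(x)+1)} · G(x,y)` of the density. -/
noncomputable def heavyTailFactor {X : Type*} (d γ γt : X → ℝ) (r ry : X → ℝ → ℝ) (x : X)
    (y : ℝ) : ℝ :=
  γ x + (γ x + γt x) * (d x * y ^ (-γt x)) + γ x * r x y - y * ry x y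

theorem heavyTailPDF_eq {p : ℕ} {c d γ γt : EuclideanSpace ℝ (Fin p) → ℝ}
    {r ry : EuclideanSpace ℝ (Fin p) → ℝ → ℝ} {x : EuclideanSpace ℝ (Fin p)} {y : ℝ}
    (hy : 0 < y) (hry : HasDerivAt (fun y' => r x y') (ry x y) y) :
    heavyTailPDF c d γ γt r x y =
      c x * (y ^ (-(γ x + 1)) * heavyTailFactor d γ γt r ry x y) := by
  have h₁ := (hasDerivAt_rpow_const (x := y) (p := -γ x) (Or.inl hy.ne')).const_mul (c x)
  have h₂ := ((hasDerivAt_rpow_const (x := y) (p := -γt x) (Or.inl hy.ne')).const_mul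
    (d x)).const_add 1 |>.add hry
  have h := ((h₁.mul h₂).const_sub 1).deriv
  refine Eq.trans h ?_
  simp only [heavyTailFactor, Pi.add_apply]
  rw [show -(γ x + 1) = -γ x - 1 by ring, rpow_sub_one hy.ne', rpow_sub_one hy.ne']
  field_simp
  ring

theorem hasC1Bound_heavyTailFactor {d γ γt : E → ℝ} {r ry : E → ℝ → ℝ} {x : E} {y : ℝ}
    {D G H : ℝ} (hy : 1 ≤ y) (hd : HasC1Bound (1 + log y) D d x)
    (hγ : HasC1Bound (1 + log y) G γ x) (hγt : HasC1Bound 1 H γt x) (hγt0 : 0 ≤ γt x)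
    (hr : HasC1Bound (1 + log y) 1 (fun z => r z y) x)
    (hry : HasC1Bound (1 + log y) 1 (fun z => y * ry z y) x) :
    HasC1Bound (1 + log y) (G + 2 * ((G + H) * (2 * (D * (1 + H)))) + 2 * (G * 1) + 1)
      (fun z => heavyTailFactor d γ γt r ry z y) x := by
  have hℓ : 1 ≤ 1 + log y := le_add_of_nonneg_right (log_nonneg hy)
  have hH : ‖fderiv ℝ γt x‖ ≤ H := by simpa using hγt.norm_fderiv_le
  have hw := HasC1Bound.rpow_neg hy hγt.differentiableAt hH
  have hw' : HasC1Bound (1 + log y) (1 + H) (fun z => y ^ (-γt z)) x := by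
    have h : (1 + H) * y ^ (-γt x) ≤ 1 + H :=
      mul_le_of_le_one_right (by linarith [hγt.nonneg])
        (rpow_le_one_of_one_le_of_nonpos hy (by linarith))
    exact ⟨hw.differentiableAt, hw.abs_le.trans h,
      hw.norm_fderiv_le.trans (mul_le_mul_of_nonneg_right h (by linarith))⟩
  have hγt' := HasC1Bound.of_le hℓ hγt.differentiableAt hγt.abs_le hH
  exact ((hγ.add ((hγ.add hγt').mul (hd.mul hw'))).add (hγ.mul hr)).sub hry

theorem tendsto_heavyTailFactor {X : Type*} {d γ γt : X → ℝ} {r ry : X → ℝ → ℝ} {x : X}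
    (hγt : 0 < γt x)
    (hr : ∀ ε > (0 : ℝ), ∃ y₀ : ℝ, ∀ y ≥ y₀, |r x y| * y ^ γt x ≤ ε)
    (hry : ∀ ε > (0 : ℝ), ∃ y₀ : ℝ, ∀ y ≥ y₀, |ry x y| * y ^ (γt x + 1) ≤ ε) :
    Tendsto (fun y => heavyTailFactor d γ γt r ry x y) atTop (nhds (γ x)) := by
  have h₁ : Tendsto (fun y => r x y) atTop (nhds 0) := by
    refine Metric.tendsto_atTop'.2 fun ε hε => ?_
    obtain ⟨y₀, h⟩ := hr (ε / 2) (half_pos hε)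
    refine ⟨max y₀ 1, fun y hy => ?_⟩
    rw [dist_zero_right, Real.norm_eq_abs]
    have := le_of_mul_rpow_le ((le_max_right _ _).trans hy.le) hγt.le (abs_nonneg _)
      (h y ((le_max_left _ _).trans hy.le))
    linarith
  have h₂ : Tendsto (fun y => y * ry x y) atTop (nhds 0) := by
    refine Metric.tendsto_atTop'.2 fun ε hε => ?_
    obtain ⟨y₀, h⟩ := hry (ε / 2) (half_pos hε)
    refine ⟨max y₀ 1, fun y hy => ?_⟩
    have hy1 : 1 ≤ y := (le_max_right _ _).trans hy.le
    rw [dist_zero_right, Real.norm_eq_abs, abs_mul, abs_of_nonneg (zero_le_one.trans hy1)]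
    have := mul_le_of_mul_rpow_add_one_le hy1 hγt.le (abs_nonneg _)
      (h y ((le_max_left _ _).trans hy.le))
    linarith
  have h₃ := (((tendsto_rpow_neg_atTop hγt).const_mul (d x)).const_mul (γ x + γt x)).const_add (γ x)
  simpa [heavyTailFactor] using (h₃.add (h₁.const_mul (γ x))).sub h₂

end C1Bounds

/-- Lemma 2(b) of the paper in the heavy-tailed case: under Condition B(i) augmented with the
density-level decay conditions on `∂_y r`, for thresholds `u_n → ∞` with
`T_n^{−η}·log u_n → 0`, eventually `f(x_0, u_n) > 0` and
`T_n^{−η}·sup_{‖x−x_0‖ ≤ T_n^{−η}} ‖∇_x f(x, u_n)‖ / f(x_0, u_n) → 0`. -/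
theorem stmt_9 (p : ℕ) (hp : 1 ≤ p) (x0 : EuclideanSpace ℝ (Fin p)) (δ : ℝ) (hδ : 0 < δ)
    (c d γ γt : EuclideanSpace ℝ (Fin p) → ℝ)
    (r ry : EuclideanSpace ℝ (Fin p) → ℝ → ℝ)
    (hc : ContDiff ℝ 1 c) (hd : ContDiff ℝ 1 d)
    (hγ : ContDiff ℝ 1 γ) (hγt : ContDiff ℝ 1 γt)
    (hcbd : ∃ c₁ c₂ : ℝ, 0 < c₁ ∧ 0 < c₂ ∧
      ∀ x ∈ Metric.closedBall x0 δ, c₁ ≤ c x ∧ c x ≤ c₂)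
    (hcgrad : ∃ C : ℝ, ∀ x ∈ Metric.closedBall x0 δ, ‖fderiv ℝ c x‖ ≤ C)
    (hdbd : ∃ C : ℝ, ∀ x ∈ Metric.closedBall x0 δ, |d x| ≤ C)
    (hdgrad : ∃ C : ℝ, ∀ x ∈ Metric.closedBall x0 δ, ‖fderiv ℝ d x‖ ≤ C)
    (hγpos : ∀ x ∈ Metric.closedBall x0 δ, 0 < γ x)
    (hγtpos : ∀ x ∈ Metric.closedBall x0 δ, 0 < γt x)
    (hγgrad : ∃ C : ℝ, ∀ x ∈ Metric.closedBall x0 δ, ‖fderiv ℝ γ x‖ ≤ C)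
    (hγtgrad : ∃ C : ℝ, ∀ x ∈ Metric.closedBall x0 δ, ‖fderiv ℝ γt x‖ ≤ C)
    (hrx : ∀ y : ℝ, 0 < y → ContDiff ℝ 1 (fun x => r x y))
    (hr0 : ∀ ε > (0 : ℝ), ∃ y₀ : ℝ, ∀ y ≥ y₀, ∀ x ∈ Metric.closedBall x0 δ,
      |r x y| * y ^ γt x ≤ ε)
    (hr1 : ∀ ε > (0 : ℝ), ∃ y₀ : ℝ, ∀ y ≥ y₀, ∀ x ∈ Metric.closedBall x0 δ,
      ‖fderiv ℝ (fun x' => r x' y) x‖ * y ^ γt x ≤ ε)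
    -- `r` is continuously differentiable in `y`, with derivative `ry`:
    (hry : ∀ x : EuclideanSpace ℝ (Fin p), ∀ y : ℝ, 0 < y →
      HasDerivAt (fun y' => r x y') (ry x y) y)
    (hrycont : ∀ x : EuclideanSpace ℝ (Fin p),
      ContinuousOn (fun y => ry x y) (Set.Ioi (0 : ℝ)))
    -- `∇_x ∂_y r` exists and is continuous:
    (hryx : ∀ y : ℝ, 0 < y → ContDiff ℝ 1 (fun x => ry x y))
    (hry0 : ∀ ε > (0 : ℝ), ∃ y₀ : ℝ, ∀ y ≥ y₀, ∀ x ∈ Metric.closedBall x0 δ,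
      |ry x y| * y ^ (γt x + 1) ≤ ε)
    (hry1 : ∀ ε > (0 : ℝ), ∃ y₀ : ℝ, ∀ y ≥ y₀, ∀ x ∈ Metric.closedBall x0 δ,
      ‖fderiv ℝ (fun x' => ry x' y) x‖ * y ^ (γt x + 1) ≤ ε)
    (η : ℝ) (hη : 0 < η) (u T : ℕ → ℝ)
    (hu : Tendsto u atTop atTop) (hT : Tendsto T atTop atTop)
    (hTu : Tendsto (fun n => (T n) ^ (-η) * Real.log (u n)) atTop (nhds 0)) :
    (∀ᶠ n in atTop, 0 < heavyTailPDF c d γ γt r x0 (u n)) ∧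
    Tendsto (fun n => (T n) ^ (-η) *
        sSup ((fun x => ‖fderiv ℝ (fun x' => heavyTailPDF c d γ γt r x' (u n)) x‖) ''
          Metric.closedBall x0 ((T n) ^ (-η))) /
        heavyTailPDF c d γ γt r x0 (u n))
      atTop (nhds 0) := by
  obtain ⟨c₁, _, hc₁, _, hcb⟩ := hcbd
  obtain ⟨C, hC⟩ := exists_hasC1Bound_closedBall hc x0 δ
  obtain ⟨D, hD⟩ := exists_hasC1Bound_closedBall hd x0 δ
  obtain ⟨G, hG⟩ := exists_hasC1Bound_closedBall hγ x0 δ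
  obtain ⟨H, hH⟩ := exists_hasC1Bound_closedBall hγt x0 δ
  have hx0 : x0 ∈ Metric.closedBall x0 δ := Metric.mem_closedBall_self hδ.le
  have hγ0 := hγpos x0 hx0
  have hGnorm : ∀ x ∈ Metric.closedBall x0 δ, ‖fderiv ℝ γ x‖ ≤ G := fun x hx => by
    simpa using (hG 1 le_rfl x hx).norm_fderiv_le
  have hG0 : 0 ≤ G := (norm_nonneg _).trans (hGnorm x0 hx0)
  have hlower : ∀ᶠ y : ℝ in atTop,
      c₁ * (y ^ (-(γ x0 + 1)) * (γ x0 / 2)) ≤ heavyTailPDF c d γ γt r x0 y := by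
    have hlim := tendsto_heavyTailFactor (d := d) (γ := γ) (hγtpos x0 hx0)
      (fun ε hε => (hr0 ε hε).imp fun _ h y hy => h y hy x0 hx0)
      (fun ε hε => (hry0 ε hε).imp fun _ h y hy => h y hy x0 hx0)
    filter_upwards [hlim.eventually (lt_mem_nhds (half_lt_self hγ0)), eventually_gt_atTop 0]
      with y hy hy0
    rw [heavyTailPDF_eq hy0 (hry x0 y hy0)]
    have hc0 := (hcb x0 hx0).1
    have := hc₁.trans_le hc0
    gcongr
  obtain ⟨K, hK0, hupper⟩ : ∃ K, 0 ≤ K ∧ ∀ᶠ y : ℝ in atTop, ∀ x ∈ Metric.closedBall x0 δ,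
      ‖fderiv ℝ (fun x' => heavyTailPDF c d γ γt r x' y) x‖ ≤
        K * y ^ (-(γ x + 1)) * (1 + log y) := by
    refine ⟨2 * (C * (2 * ((1 + G) *
      (G + 2 * ((G + H) * (2 * (D * (1 + H)))) + 2 * (G * 1) + 1)))), ?_, ?_⟩
    · have := (hC 1 le_rfl x0 hx0).nonneg
      have := (hD 1 le_rfl x0 hx0).nonneg
      have := (hH 1 le_rfl x0 hx0).nonneg
      positivity
    obtain ⟨y₁, h₁⟩ := hr0 1 one_pos
    obtain ⟨y₂, h₂⟩ := hr1 1 one_pos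
    obtain ⟨y₃, h₃⟩ := hry0 1 one_pos
    obtain ⟨y₄, h₄⟩ := hry1 1 one_pos
    filter_upwards [eventually_ge_atTop 1, eventually_ge_atTop y₁, eventually_ge_atTop y₂,
      eventually_ge_atTop y₃, eventually_ge_atTop y₄] with y hy hy₁ hy₂ hy₃ hy₄ x hx
    have hy0 : 0 < y := one_pos.trans_le hy
    have hℓ : 1 ≤ 1 + log y := le_add_of_nonneg_right (log_nonneg hy)
    have ht := (hγtpos x hx).le
    have hr' : HasC1Bound (1 + log y) 1 (fun z => r z y) x :=
      .of_le hℓ ((hrx y hy0).differentiable one_ne_zero x)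
        (le_of_mul_rpow_le hy ht (abs_nonneg _) (h₁ y hy₁ x hx))
        (le_of_mul_rpow_le hy ht (norm_nonneg _) (h₂ y hy₂ x hx))
    have hry' : HasC1Bound (1 + log y) 1 (fun z => y * ry z y) x := by
      have hdiff := (hryx y hy0).differentiable one_ne_zero x
      refine .of_le hℓ (hdiff.const_mul y) ?_ ?_
      · rw [abs_mul, abs_of_pos hy0]
        exact mul_le_of_mul_rpow_add_one_le hy ht (abs_nonneg _) (h₃ y hy₃ x hx)
      · rw [fderiv_const_mul hdiff, norm_smul, Real.norm_eq_abs, abs_of_pos hy0]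
        exact mul_le_of_mul_rpow_add_one_le hy ht (norm_nonneg _) (h₄ y hy₄ x hx)
    have hfac := hasC1Bound_heavyTailFactor hy (hD _ hℓ x hx) (hG _ hℓ x hx)
      (hH 1 le_rfl x hx) ht hr' hry'
    have hw := HasC1Bound.rpow_neg (f := fun z => γ z + 1) (b := G) hy
      ((hγ.differentiable one_ne_zero x).add_const 1)
      (by rw [fderiv_add_const]; exact hGnorm x hx)
    rw [show (fun x' => heavyTailPDF c d γ γt r x' y) = _ from
      funext fun x' => heavyTailPDF_eq hy0 (hry x' y hy0)]
    refine ((hC _ hℓ x hx).mul (hw.mul hfac)).norm_fderiv_le.trans (le_of_eq ?_)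
    ring
  have hpos : ∀ᶠ n in atTop, 0 < heavyTailPDF c d γ γt r x0 (u n) := by
    filter_upwards [hu.eventually hlower, hu.eventually_gt_atTop 0] with n hn hn0
    exact lt_of_lt_of_le (by positivity) hn
  refine ⟨hpos, ?_⟩
  have hT0 : Tendsto (fun n => T n ^ (-η)) atTop (nhds 0) := (tendsto_rpow_neg_atTop hη).comp hT
  have hbound : Tendsto (fun n => 2 * K / (c₁ * γ x0) *
      (T n ^ (-η) + T n ^ (-η) * log (u n)) * exp (G * (T n ^ (-η) * log (u n))))
      atTop (nhds 0) := by
    have h := ((hT0.add hTu).const_mul (2 * K / (c₁ * γ x0))).mul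
      ((continuous_exp.tendsto _).comp (hTu.const_mul G))
    simpa using h
  refine squeeze_zero' ?_ ?_ hbound
  · filter_upwards [hpos, hT.eventually_ge_atTop 0] with n hn hTn
    refine div_nonneg (mul_nonneg (rpow_nonneg hTn _) (Real.sSup_nonneg ?_)) hn.le
    rintro _ ⟨x, _, rfl⟩
    exact norm_nonneg _
  · filter_upwards [hpos, hu.eventually hlower, hu.eventually hupper, hu.eventually_ge_atTop 1,
      hT.eventually_ge_atTop 0, hT0.eventually (ge_mem_nhds hδ)] with n hn hlow hup hun hTn htδ
    have hu0 : 0 < u n := one_pos.trans_le hun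
    have hL := log_nonneg hun
    have ht : 0 ≤ T n ^ (-η) := rpow_nonneg hTn _
    generalize T n ^ (-η) = t at *
    have hsup : sSup ((fun x => ‖fderiv ℝ (fun x' => heavyTailPDF c d γ γt r x' (u n)) x‖) ''
        Metric.closedBall x0 t) ≤
        K * (u n ^ (-(γ x0 + 1)) * exp (G * (t * log (u n)))) * (1 + log (u n)) := by
      refine Real.sSup_le ?_ (by positivity)
      rintro _ ⟨x, hx, rfl⟩
      have hxδ := Metric.closedBall_subset_closedBall htδ hx
      refine (hup x hxδ).trans ?_
      have hγx : γ x0 - γ x ≤ G * t := by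
        have h := (convex_closedBall x0 δ).norm_image_sub_le_of_norm_fderiv_le
          (fun z _ => hγ.differentiable one_ne_zero z) hGnorm hxδ hx0
        rw [← dist_eq_norm x0 x, dist_comm] at h
        exact (le_abs_self _).trans (h.trans (mul_le_mul_of_nonneg_left hx hG0))
      gcongr
      rw [rpow_def_of_pos hu0, rpow_def_of_pos hu0, ← exp_add]
      gcongr
      nlinarith [mul_le_mul_of_nonneg_right hγx hL]
    rw [div_le_iff₀ hn]
    calc _ ≤ t * (K * (u n ^ (-(γ x0 + 1)) * exp (G * (t * log (u n)))) * (1 + log (u n))) := by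
          gcongr
      _ = 2 * K / (c₁ * γ x0) * (t + t * log (u n)) * exp (G * (t * log (u n))) *
          (c₁ * (u n ^ (-(γ x0 + 1)) * (γ x0 / 2))) := by
          field_simp
      _ ≤ _ := by gcongr
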